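/- Let n be a positive integer and let σ be the automorphism of (ℤ/nℤ) × (ℤ/nℤ) given by σ(x,y) = (y,x). The number of subgroups H of (ℤ/nℤ) × (ℤ/nℤ) with σ(H) = H equals β(n). -/

import Mathlib

/-- `β(n) = β₂(n) · ∏_{p odd prime, p | n} (v_p(n)+1)²`, where
`β₂(n) = 2·v₂(n)² − 2·v₂(n) + 3` if `n` is even and `β₂(n) = 1` if `n` is odd. -/
def betaFun (n : ℕ) : ℕ :=
  (if 2 ∣ n then 2 * (n.factorization 2) ^ 2 - 2 * (n.factorization 2) + 3 else 1) *
    ∏ p ∈ n.primeFactors.erase 2, (n.factorization p + 1) ^ 2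

section

open Finset ArithmeticFunction

/-- The square roots of `1` modulo `d`, as natural numbers below `d`. -/
def sqrtOneMod (d : ℕ) : Finset ℕ :=
  {t ∈ range d | (d : ℤ) ∣ (t : ℤ) * t - 1}

lemma natCast_dvd_intCast_zmod {n k : ℕ} (hk : k ∣ n) (x : ℤ) :
    ((k : ℤ) : ZMod n) ∣ (x : ZMod n) ↔ (k : ℤ) ∣ x := by
  constructor
  · rintro ⟨c, hc⟩
    obtain ⟨c, rfl⟩ := ZMod.intCast_surjective c
    rw [← Int.cast_mul, ZMod.intCast_eq_intCast_iff_dvd_sub] at hc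
    have h1 : (k : ℤ) ∣ k * c - x := (Int.natCast_dvd_natCast.2 hk).trans hc
    exact (dvd_sub_right (dvd_mul_right _ _)).1 h1
  · rintro ⟨c, rfl⟩
    exact ⟨c, by push_cast; rfl⟩

/-- The subgroup of `ℤ/n × ℤ/n` generated by `(a, a t)` and `(0, a d)`, given by congruences. -/
def swapSubgroup (n a d t : ℕ) : AddSubgroup (ZMod n × ZMod n) where
  carrier := {p | ((a : ℤ) : ZMod n) ∣ p.1 ∧
    (((a * d : ℕ) : ℤ) : ZMod n) ∣ p.2 - ((t : ℤ) : ZMod n) * p.1}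
  zero_mem' := by simp
  add_mem' := by
    rintro ⟨x, y⟩ ⟨x', y'⟩ ⟨h1, h2⟩ ⟨h3, h4⟩
    refine ⟨dvd_add h1 h3, ?_⟩
    convert dvd_add h2 h4 using 1
    simp only [Prod.fst_add, Prod.snd_add]
    ring
  neg_mem' := by
    rintro ⟨x, y⟩ ⟨h1, h2⟩
    refine ⟨(dvd_neg).2 h1, ?_⟩
    convert (dvd_neg).2 h2 using 1
    simp only [Prod.fst_neg, Prod.snd_neg]
    ring

lemma mem_swapSubgroup {n a d : ℕ} (t : ℕ) (h : a * d ∣ n) (x y : ℤ) :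
    ((x : ZMod n), (y : ZMod n)) ∈ swapSubgroup n a d t ↔
      (a : ℤ) ∣ x ∧ (a : ℤ) * d ∣ y - t * x := by
  have h1 := natCast_dvd_intCast_zmod ((dvd_mul_right a d).trans h) x
  have h2 := natCast_dvd_intCast_zmod h (y - t * x)
  rw [Int.cast_sub, Int.cast_mul (t : ℤ) x] at h2
  rw [Nat.cast_mul a d] at h2
  rw [← h1, ← h2, ← Nat.cast_mul]
  rfl

lemma swap_mem_swapSubgroup {n a d t : ℕ} (h : a * d ∣ n) (ht : (d : ℤ) ∣ (t : ℤ) * t - 1)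
    {x y : ℤ} (hxy : ((x : ZMod n), (y : ZMod n)) ∈ swapSubgroup n a d t) :
    ((y : ZMod n), (x : ZMod n)) ∈ swapSubgroup n a d t := by
  rw [mem_swapSubgroup t h] at hxy ⊢
  obtain ⟨h1, h2⟩ := hxy
  constructor
  · have := dvd_add ((dvd_mul_right (a : ℤ) d).trans h2) (h1.mul_left (t : ℤ))
    simpa using this
  · have := dvd_add (h2.mul_left (-(t : ℤ))) ((mul_dvd_mul h1 ht).mul_left (-1))
    rw [show (x : ℤ) - t * y = -t * (y - t * x) + -1 * (x * (t * t - 1)) by ring]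
    exact this

lemma swapSubgroup_injective {n a d t a' d' t' : ℕ} (hn : 0 < n) (h : a * d ∣ n)
    (h' : a' * d' ∣ n) (ht : t < d) (ht' : t' < d')
    (he : swapSubgroup n a d t = swapSubgroup n a' d' t') : a = a' ∧ d = d' ∧ t = t' := by
  have key : ∀ x y : ℤ, ((a : ℤ) ∣ x ∧ (a : ℤ) * d ∣ y - t * x) ↔
      ((a' : ℤ) ∣ x ∧ (a' : ℤ) * d' ∣ y - t' * x) := fun x y => by
    rw [← mem_swapSubgroup t h, ← mem_swapSubgroup t' h', he]
  have ha : a = a' := by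
    apply Nat.dvd_antisymm
    · exact_mod_cast ((key a' (t' * a')).2 (by simp)).1
    · exact_mod_cast ((key a (t * a)).1 (by simp)).1
  subst ha
  have ha0 : 0 < a := Nat.pos_of_dvd_of_pos ((dvd_mul_right a d).trans h) hn
  have haz : (a : ℤ) ≠ 0 := by exact_mod_cast ha0.ne'
  have hd : d = d' := by
    apply Nat.dvd_antisymm
    · have := ((key 0 (a * d')).2 (by simp)).2
      rw [mul_zero, sub_zero, mul_dvd_mul_iff_left haz] at this
      exact_mod_cast this
    · have := ((key 0 (a * d)).1 (by simp)).2
      rw [mul_zero, sub_zero, mul_dvd_mul_iff_left haz] at this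
      exact_mod_cast this
  subst hd
  refine ⟨rfl, rfl, ?_⟩
  have := ((key a (t * a)).1 (by simp)).2
  rw [← sub_mul, mul_comm (_ - _), mul_dvd_mul_iff_left haz] at this
  have h3 := (Nat.modEq_iff_dvd.2 this).symm
  exact Nat.ModEq.eq_of_lt_of_lt h3 ht ht'

lemma exists_natCast_dvd_iff_mem (A : AddSubgroup ℤ) : ∃ a : ℕ, ∀ x, x ∈ A ↔ (a : ℤ) ∣ x := by
  obtain ⟨a, rfl⟩ := Int.subgroup_cyclic A
  refine ⟨a.natAbs, fun x => ?_⟩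
  rw [← AddSubgroup.zmultiples_eq_closure, Int.mem_zmultiples_iff, Int.natAbs_dvd]

lemma exists_eq_swapSubgroup {n : ℕ} (hn : 0 < n) (H : AddSubgroup (ZMod n × ZMod n))
    (hH : ∀ p : ZMod n × ZMod n, p ∈ H ↔ (p.2, p.1) ∈ H) :
    ∃ a d t : ℕ, a * d ∣ n ∧ t ∈ sqrtOneMod d ∧ swapSubgroup n a d t = H := by
  let L : AddSubgroup (ℤ × ℤ) :=
    H.comap ((Int.castAddHom (ZMod n)).prodMap (Int.castAddHom (ZMod n)))
  have hL : ∀ x y : ℤ, (x, y) ∈ L ↔ ((x : ZMod n), (y : ZMod n)) ∈ H := fun x y => Iff.rfl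
  have hswap : ∀ {x y : ℤ}, (x, y) ∈ L → (y, x) ∈ L := fun {x y} h => by
    rw [hL] at h ⊢
    exact (hH _).1 h
  have hsub : ∀ {x y x' y' : ℤ} (k : ℤ), (x, y) ∈ L →
      ((x' - k * x, y' - k * y) ∈ L ↔ (x', y') ∈ L) := fun {x y x' y'} k h => by
    have : (x' - k * x, y' - k * y) = (x', y') - k • (x, y) := by simp
    rw [this]
    rw [sub_eq_add_neg, L.add_mem_cancel_right (L.neg_mem (L.zsmul_mem h k))]
  obtain ⟨a, ha⟩ := exists_natCast_dvd_iff_mem (L.map (AddMonoidHom.fst ℤ ℤ))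
  obtain ⟨b, hb⟩ := exists_natCast_dvd_iff_mem (L.comap (AddMonoidHom.inr ℤ ℤ))
  replace ha : ∀ x : ℤ, (a : ℤ) ∣ x ↔ ∃ y, (x, y) ∈ L := fun x => by
    rw [← ha]; simp [AddSubgroup.mem_map]
  replace hb : ∀ y : ℤ, (b : ℤ) ∣ y ↔ (0, y) ∈ L := fun y => by
    rw [← hb]; simp [AddSubgroup.mem_comap]
  have hbn : b ∣ n := by
    have : (b : ℤ) ∣ n := (hb n).2 (by
      rw [hL, Int.cast_zero, Int.cast_natCast, ZMod.natCast_self]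
      exact H.zero_mem)
    exact_mod_cast this
  have hab : a ∣ b := by
    have : (a : ℤ) ∣ b := (ha b).2 ⟨0, hswap ((hb b).1 dvd_rfl)⟩
    exact_mod_cast this
  obtain ⟨d, rfl⟩ := hab
  have hb0 : 0 < a * d := Nat.pos_of_dvd_of_pos hbn hn
  have haz : (a : ℤ) ≠ 0 := by
    have := Nat.pos_of_mul_pos_right hb0
    omega
  have hdz : (d : ℤ) ≠ 0 := by
    have := Nat.pos_of_mul_pos_left hb0
    omega
  push_cast at hb
  obtain ⟨s, hs⟩ := (ha a).1 dvd_rfl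
  have has : (a : ℤ) ∣ s := by
    have h1 : ((a : ℤ) * d, 0) ∈ L := hswap ((hb _).1 dvd_rfl)
    have h2 := (hsub (d : ℤ) hs).2 h1
    rw [mul_comm, sub_self, ← hb, zero_sub, dvd_neg, mul_comm, mul_dvd_mul_iff_left hdz] at h2
    exact h2
  obtain ⟨t₀, rfl⟩ := has
  obtain ⟨t, ht⟩ := Int.eq_ofNat_of_zero_le (Int.emod_nonneg t₀ hdz)
  have htd : t < d := by
    have := Int.emod_lt_of_pos t₀ (b := d) (by omega)
    omega
  have hat : ((a : ℤ), (a : ℤ) * t) ∈ L := by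
    rw [← hsub 1 hs, one_mul, one_mul, sub_self, ← hb, ← mul_sub, mul_dvd_mul_iff_left haz]
    exact ⟨-(t₀ / d), by linear_combination -ht + Int.emod_def t₀ d⟩
  refine ⟨a, d, t, hbn, ?_, ?_⟩
  · rw [sqrtOneMod, mem_filter, mem_range]
    refine ⟨htd, ?_⟩
    have h2 := (hsub (t : ℤ) hat).2 (hswap hat)
    rw [mul_comm, sub_self, ← hb, ← dvd_neg] at h2
    rw [← mul_dvd_mul_iff_left haz]
    convert h2 using 1
    ring
  · ext ⟨x, y⟩
    obtain ⟨x, rfl⟩ := ZMod.intCast_surjective x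
    obtain ⟨y, rfl⟩ := ZMod.intCast_surjective y
    rw [mem_swapSubgroup t hbn, ← hL]
    have main : ∀ u : ℤ, (a : ℤ) * d ∣ y - t * (a * u) ↔ ((a : ℤ) * u, y) ∈ L := fun u => by
      rw [← hsub u hat, hb]
      ring_nf
    constructor
    · rintro ⟨⟨u, rfl⟩, h⟩
      exact (main u).1 h
    · intro h
      obtain ⟨u, rfl⟩ := (ha x).2 ⟨y, h⟩
      exact ⟨dvd_mul_right _ _, (main u).2 h⟩

lemma card_swap_invariant_addSubgroup {n : ℕ} (hn : 0 < n) :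
    Nat.card {H : AddSubgroup (ZMod n × ZMod n) //
      ∀ p : ZMod n × ZMod n, p ∈ H ↔ (p.2, p.1) ∈ H} =
      ∑ d ∈ n.divisors, #(sqrtOneMod d) * #(n / d).divisors := by
  let S : Finset (Σ _ : ℕ, ℕ × ℕ) :=
    n.divisors.sigma fun d => sqrtOneMod d ×ˢ (n / d).divisors
  have hS : ∀ d t a, (⟨d, t, a⟩ : Σ _ : ℕ, ℕ × ℕ) ∈ S ↔ a * d ∣ n ∧ t ∈ sqrtOneMod d := by
    intro d t a
    simp only [S, mem_sigma, mem_product, Nat.mem_divisors]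
    constructor
    · rintro ⟨⟨hd, -⟩, ht, ha, -⟩
      exact ⟨by rw [mul_comm]; exact (Nat.dvd_div_iff_mul_dvd hd).1 ha, ht⟩
    · rintro ⟨h, ht⟩
      have hd : d ∣ n := (dvd_mul_left d a).trans h
      refine ⟨⟨hd, hn.ne'⟩, ht, (Nat.dvd_div_iff_mul_dvd hd).2 (by rwa [mul_comm]), ?_⟩
      exact (Nat.div_pos (Nat.le_of_dvd hn hd) (Nat.pos_of_dvd_of_pos hd hn)).ne'
  have hcard : ∑ d ∈ n.divisors, #(sqrtOneMod d) * #(n / d).divisors = Nat.card S := by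
    rw [Nat.card_eq_fintype_card, Fintype.card_coe, card_sigma]
    simp only [card_product]
  rw [hcard]
  symm
  have hinv : ∀ s : S, ∀ p : ZMod n × ZMod n, p ∈ swapSubgroup n s.1.2.2 s.1.1 s.1.2.1 ↔
      (p.2, p.1) ∈ swapSubgroup n s.1.2.2 s.1.1 s.1.2.1 := by
    rintro ⟨⟨d, t, a⟩, hs⟩ ⟨x, y⟩
    obtain ⟨h, ht⟩ := (hS _ _ _).1 hs
    obtain ⟨x, rfl⟩ := ZMod.intCast_surjective x
    obtain ⟨y, rfl⟩ := ZMod.intCast_surjective y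
    have ht2 := (mem_filter.1 ht).2
    exact ⟨swap_mem_swapSubgroup h ht2, swap_mem_swapSubgroup h ht2⟩
  refine Nat.card_eq_of_bijective
    (fun s : S => ⟨swapSubgroup n s.1.2.2 s.1.1 s.1.2.1, hinv s⟩) ⟨?_, ?_⟩
  · rintro ⟨⟨d, t, a⟩, hs⟩ ⟨⟨d', t', a'⟩, hs'⟩ he
    obtain ⟨h, ht⟩ := (hS _ _ _).1 hs
    obtain ⟨h', ht'⟩ := (hS _ _ _).1 hs'
    obtain ⟨rfl, rfl, rfl⟩ := swapSubgroup_injective hn h h'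
      (mem_range.1 (mem_filter.1 ht).1) (mem_range.1 (mem_filter.1 ht').1)
      (Subtype.ext_iff.1 he)
    rfl
  · rintro ⟨H, hH⟩
    obtain ⟨a, d, t, h, ht, he⟩ := exists_eq_swapSubgroup hn H hH
    exact ⟨⟨⟨d, t, a⟩, (hS _ _ _).2 ⟨h, ht⟩⟩, Subtype.ext he⟩

lemma card_sqrtOneMod_eq_card_zmod {d : ℕ} [NeZero d] :
    #(sqrtOneMod d) = Nat.card {x : ZMod d // x * x = 1} := by
  rw [Nat.card_eq_fintype_card, Fintype.card_subtype]
  have hiff : ∀ t : ℕ, (d : ℤ) ∣ (t : ℤ) * t - 1 ↔ (t : ZMod d) * t = 1 := fun t => by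
    rw [← sub_eq_zero, ← ZMod.intCast_zmod_eq_zero_iff_dvd]
    push_cast
    rfl
  refine card_bij (fun t _ => (t : ZMod d)) ?_ ?_ ?_
  · intro t ht
    simpa using (hiff t).1 (mem_filter.1 ht).2
  · intro t ht t' ht' h
    exact Nat.ModEq.eq_of_lt_of_lt ((ZMod.natCast_eq_natCast_iff _ _ _).1 h)
      (mem_range.1 (mem_filter.1 ht).1) (mem_range.1 (mem_filter.1 ht').1)
  · intro x hx
    refine ⟨x.val, mem_filter.2 ⟨mem_range.2 x.val_lt, (hiff _).2 ?_⟩, ?_⟩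
    · simpa using hx
    · simp

lemma card_sqrtOneMod_mul {m n : ℕ} (h : m.Coprime n) :
    #(sqrtOneMod (m * n)) = #(sqrtOneMod m) * #(sqrtOneMod n) := by
  rcases Nat.eq_zero_or_pos m with rfl | hm
  · simp [sqrtOneMod]
  rcases Nat.eq_zero_or_pos n with rfl | hn
  · simp [sqrtOneMod]
  have : NeZero m := ⟨hm.ne'⟩
  have : NeZero n := ⟨hn.ne'⟩
  rw [card_sqrtOneMod_eq_card_zmod, card_sqrtOneMod_eq_card_zmod, card_sqrtOneMod_eq_card_zmod,
    ← Nat.card_prod]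
  let e := ZMod.chineseRemainder h
  refine Nat.card_congr ((e.toEquiv.subtypeEquiv
    (q := fun x => x.1 * x.1 = 1 ∧ x.2 * x.2 = 1) fun x => ?_).trans (Equiv.subtypeProdEquivProd
      (p := fun x : ZMod m => x * x = 1) (q := fun x : ZMod n => x * x = 1)))
  rw [← e.injective.eq_iff, map_mul, map_one, Prod.ext_iff]
  rfl

/-- The number of square roots of `1` modulo `d`, as an arithmetic function. -/
def numSqrtOne : ArithmeticFunction ℕ := ⟨fun d => #(sqrtOneMod d), by simp [sqrtOneMod]⟩

lemma numSqrtOne_apply (d : ℕ) : numSqrtOne d = #(sqrtOneMod d) := rfl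

lemma numSqrtOne_one : numSqrtOne 1 = 1 := by decide

lemma isMultiplicative_numSqrtOne : numSqrtOne.IsMultiplicative :=
  ⟨numSqrtOne_one, card_sqrtOneMod_mul⟩

lemma prime_pow_dvd_of_dvd_mul {p k : ℕ} (hp : p.Prime) {x y : ℤ} (h : (p : ℤ) ^ k ∣ x * y)
    (hxy : ¬ ((p : ℤ) ∣ x ∧ (p : ℤ) ∣ y)) : (p : ℤ) ^ k ∣ x ∨ (p : ℤ) ^ k ∣ y := by
  have hp' := Nat.prime_iff_prime_int.1 hp
  by_cases hx : (p : ℤ) ∣ x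
  · exact Or.inl (hp'.pow_dvd_of_dvd_mul_right k (fun hy => hxy ⟨hx, hy⟩) h)
  · exact Or.inr (hp'.pow_dvd_of_dvd_mul_left k hx h)

lemma numSqrtOne_odd_prime_pow {p k : ℕ} (hp : p.Prime) (hp2 : p ≠ 2) (hk : k ≠ 0) :
    numSqrtOne (p ^ k) = 2 := by
  have hp3 : 3 ≤ p := by have := hp.two_le; omega
  have hpk : p ≤ p ^ k := Nat.le_self_pow hk p
  have hroots : sqrtOneMod (p ^ k) = {1, p ^ k - 1} := by
    ext t
    rw [sqrtOneMod, mem_filter, mem_range, mem_insert, mem_singleton]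
    constructor
    · rintro ⟨htd, ht⟩
      have hmul : (p : ℤ) ^ k ∣ ((t : ℤ) - 1) * (t + 1) := by
        push_cast at ht
        convert ht using 1
        ring
      rcases prime_pow_dvd_of_dvd_mul hp hmul (fun ⟨h1, h2⟩ => by
        have h3 := Int.le_of_dvd (by norm_num) ((dvd_sub h2 h1).trans (by ring_nf; rfl : _ ∣ (2 : ℤ)))
        omega) with h | h
      · left
        have h4 : (t : ℤ) - 1 = 0 := by
          apply Int.eq_zero_of_abs_lt_dvd h
          have htd' : (t : ℤ) < (p : ℤ) ^ k := by exact_mod_cast htd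
          have hpk' : (3 : ℤ) ≤ (p : ℤ) ^ k := by exact_mod_cast hp3.trans hpk
          rw [abs_lt]
          omega
        omega
      · right
        have h4 := Int.le_of_dvd (by omega) h
        norm_cast at h4
        omega
    · rintro (rfl | rfl)
      · exact ⟨by omega, by simp⟩
      · refine ⟨by omega, ?_⟩
        rw [Nat.cast_sub (by omega)]
        exact ⟨(p ^ k : ℕ) - 2, by push_cast; ring⟩
  rw [numSqrtOne_apply, hroots, card_pair (by omega)]

lemma numSqrtOne_two_pow {k : ℕ} : numSqrtOne (2 ^ (k + 3)) = 4 := by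
  obtain ⟨q, hq⟩ : ∃ q, q = 2 ^ (k + 1) := ⟨_, rfl⟩
  have hq2 : 2 ≤ q := hq ▸ Nat.le_self_pow (by omega) 2
  have hd : 2 ^ (k + 3) = 4 * q := by rw [hq]; ring
  obtain ⟨r, hr⟩ : ∃ r, q = 2 * r := ⟨2 ^ k, by rw [hq]; ring⟩
  have hroots : sqrtOneMod (4 * q) = {1, 2 * q - 1, 2 * q + 1, 4 * q - 1} := by
    ext t
    simp only [sqrtOneMod, mem_filter, mem_range, mem_insert, mem_singleton]
    constructor
    · rintro ⟨htd, ht⟩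
      have hodd : Odd t := by
        by_contra he
        obtain ⟨v, rfl⟩ := Nat.not_odd_iff_even.1 he
        obtain ⟨c, hc⟩ := ht
        push_cast at hc
        have : 2 * (2 * ((v : ℤ) * v) - 2 * (q * c)) = 1 := by linear_combination hc
        omega
      obtain ⟨u, rfl⟩ := hodd
      have hmul : ((2 : ℕ) : ℤ) ^ (k + 1) ∣ (u : ℤ) * (u + 1) := by
        rw [← Nat.cast_pow, ← hq, ← mul_dvd_mul_iff_left (by norm_num : (4 : ℤ) ≠ 0)]
        rw [show (4 : ℤ) * (u * (u + 1)) = (2 * u + 1) * (2 * u + 1) - 1 by ring]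
        exact_mod_cast ht
      have := prime_pow_dvd_of_dvd_mul Nat.prime_two hmul (by omega)
      rw [← Nat.cast_pow, ← hq] at this
      rcases this with ⟨v, hv⟩ | ⟨v, hv⟩
      · have hv0 : 0 ≤ v := by
          by_contra hneg
          nlinarith
        have hv2 : v < 2 := by
          by_contra hge
          nlinarith
        interval_cases v <;> omega
      · have hv0 : 0 < v := by
          by_contra hneg
          nlinarith
        have hv2 : v < 3 := by
          by_contra hge
          nlinarith
        interval_cases v <;> omega
    · have h1 : ((2 * q - 1 : ℕ) : ℤ) = 2 * q - 1 := by omega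
      have h2 : ((4 * q - 1 : ℕ) : ℤ) = 4 * q - 1 := by omega
      rintro (rfl | rfl | rfl | rfl)
      · exact ⟨by omega, by simp⟩
      · exact ⟨by omega, q - 1, by rw [h1]; push_cast; ring⟩
      · exact ⟨by omega, q + 1, by push_cast; ring⟩
      · exact ⟨by omega, 4 * q - 2, by rw [h2]; push_cast; ring⟩
  rw [hd, numSqrtOne_apply, hroots]
  repeat rw [card_insert_of_notMem (by simp only [mem_insert, mem_singleton]; omega)]
  rw [card_singleton]

lemma sum_range_mul_succ_sub (c : ℕ → ℕ) (k : ℕ) :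
    ∑ i ∈ range (k + 2), c i * (k + 1 - i + 1) =
      ∑ i ∈ range (k + 1), c i * (k - i + 1) + ∑ i ∈ range (k + 2), c i := by
  rw [sum_range_succ, sum_range_succ c (k + 1), Nat.sub_self, ← add_assoc, ← sum_add_distrib]
  congr 1
  · refine sum_congr rfl fun i hi => ?_
    have : k + 1 - i = k - i + 1 := by
      have := mem_range.1 hi
      omega
    rw [this]
    ring
  · ring

lemma numSqrtOne_mul_sigma_prime_pow {p : ℕ} (hp : p.Prime) (k : ℕ) :
    (numSqrtOne * sigma 0) (p ^ k) =
      ∑ i ∈ range (k + 1), numSqrtOne (p ^ i) * (k - i + 1) := by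
  rw [mul_apply, Nat.sum_divisorsAntidiagonal (fun i j => numSqrtOne i * sigma 0 j),
    Nat.sum_divisors_prime_pow hp]
  refine sum_congr rfl fun i hi => ?_
  rw [Nat.pow_div (by have := mem_range.1 hi; omega) hp.pos, sigma_zero_apply_prime_pow hp]

lemma numSqrtOne_mul_sigma_odd_prime_pow {p : ℕ} (hp : p.Prime) (hp2 : p ≠ 2) (k : ℕ) :
    (numSqrtOne * sigma 0) (p ^ k) = (k + 1) ^ 2 := by
  have hsum : ∀ k, ∑ i ∈ range (k + 1), numSqrtOne (p ^ i) = 2 * k + 1 := fun k => by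
    induction k with
    | zero => simp [numSqrtOne_one]
    | succ k ih =>
      rw [sum_range_succ, ih, numSqrtOne_odd_prime_pow hp hp2 (by omega)]
      ring
  rw [numSqrtOne_mul_sigma_prime_pow hp]
  induction k with
  | zero => simp [numSqrtOne_one]
  | succ k ih =>
    rw [sum_range_mul_succ_sub (fun i => numSqrtOne (p ^ i)), ih, hsum]
    ring

lemma numSqrtOne_mul_sigma_two_pow (k : ℕ) :
    (numSqrtOne * sigma 0) (2 ^ (k + 1)) = 2 * (k + 1) ^ 2 - 2 * (k + 1) + 3 := by
  have h2 : numSqrtOne 2 = 1 := by decide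
  have h4 : numSqrtOne 4 = 2 := by decide
  have hsum : ∀ k, ∑ i ∈ range (k + 3), numSqrtOne (2 ^ i) = 4 * (k + 1) := fun k => by
    induction k with
    | zero => simp [sum_range_succ, numSqrtOne_one, h2, h4]
    | succ k ih =>
      rw [sum_range_succ, ih, numSqrtOne_two_pow]
      ring
  have hmain : (numSqrtOne * sigma 0) (2 ^ (k + 1)) = 2 * k * (k + 1) + 3 := by
    rw [numSqrtOne_mul_sigma_prime_pow Nat.prime_two]
    induction k with
    | zero => simp [sum_range_succ, numSqrtOne_one, h2]
    | succ k ih =>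
      rw [sum_range_mul_succ_sub (fun i => numSqrtOne (2 ^ i)), ih, hsum]
      ring
  rw [hmain, show 2 * (k + 1) ^ 2 = 2 * k * (k + 1) + 2 * (k + 1) by ring, Nat.add_sub_cancel]

lemma numSqrtOne_mul_sigma_eq_betaFun {n : ℕ} (hn : n ≠ 0) :
    (numSqrtOne * sigma 0) n = betaFun n := by
  rw [(isMultiplicative_numSqrtOne.mul isMultiplicative_sigma).multiplicative_factorization _ hn,
    Finsupp.prod, Nat.support_factorization, betaFun]
  have hodd : ∏ p ∈ n.primeFactors.erase 2, (numSqrtOne * sigma 0) (p ^ n.factorization p) =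
      ∏ p ∈ n.primeFactors.erase 2, (n.factorization p + 1) ^ 2 :=
    prod_congr rfl fun p hp => by
      obtain ⟨hp2, hp⟩ := mem_erase.1 hp
      exact numSqrtOne_mul_sigma_odd_prime_pow (Nat.prime_of_mem_primeFactors hp) hp2 _
  by_cases h2 : 2 ∣ n
  · have hmem : 2 ∈ n.primeFactors := Nat.mem_primeFactors.2 ⟨Nat.prime_two, h2, hn⟩
    rw [← mul_prod_erase _ _ hmem, hodd, if_pos h2]
    obtain ⟨k, hk⟩ := Nat.exists_eq_succ_of_ne_zero
      (Nat.prime_two.factorization_pos_of_dvd hn h2).ne'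
    rw [hk, Nat.succ_eq_add_one, numSqrtOne_mul_sigma_two_pow]
  · have hmem : 2 ∉ n.primeFactors := fun h => h2 (Nat.dvd_of_mem_primeFactors h)
    rw [if_neg h2, one_mul, ← hodd, erase_eq_of_notMem hmem]

end

/-- Let `n` be a positive integer and let `σ` be the automorphism of `(ℤ/nℤ) × (ℤ/nℤ)`
given by `σ(x,y) = (y,x)`.  The number of subgroups `H` of `(ℤ/nℤ) × (ℤ/nℤ)` with
`σ(H) = H` equals `β(n)`. -/
theorem stmt4 (n : ℕ) (hn : 0 < n) :
    Nat.card {H : AddSubgroup (ZMod n × ZMod n) //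
      ∀ p : ZMod n × ZMod n, p ∈ H ↔ (p.2, p.1) ∈ H} = betaFun n := by
  rw [card_swap_invariant_addSubgroup hn, ← numSqrtOne_mul_sigma_eq_betaFun hn.ne',
    ArithmeticFunction.mul_apply,
    Nat.sum_divisorsAntidiagonal (fun i j => numSqrtOne i * ArithmeticFunction.sigma 0 j)]
  simp only [numSqrtOne_apply, ArithmeticFunction.sigma_zero_apply]
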